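/- There exists an absolute constant C > 0 such that the following holds. Let (d_1,…,d_n) be positive integers with even sum such that d_max^4 ≤ (d−2)n, and let x and x′ be suitable degree sequences that are adjacent, i.e. there are indices j ≠ k with x′_j = x_j + 1, x′_k = x_k − 1, and x′_i = x_i for all i ∉ {j,k}. Then |g(x) − g(x′)| ≤ C · d_max² / ((d−2)n). -/

import Mathlib

attribute [local instance] Classical.propDecidable

namespace ExpectedSpanningTrees

/-- Average degree `d` of the degree sequence. -/
noncomputable def davg (n : ℕ) (d : Fin n → ℕ) : ℝ := (∑ j, (d j : ℝ)) / n

/-- The variance-type quantity `R = (1/n) Σ (d_j − d)²`. -/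
noncomputable def Rvar (n : ℕ) (d : Fin n → ℕ) : ℝ :=
  (∑ j, ((d j : ℝ) - davg n d) ^ 2) / n

/-- `λ(x) = (1/(2(d−2)n+4)) Σ_j (d_j−x_j)_2`. -/
noncomputable def lamx (n : ℕ) (d x : Fin n → ℕ) : ℝ :=
  (∑ j, (Nat.descFactorial (d j - x j) 2 : ℝ)) / (2 * ((davg n d - 2) * n) + 4)

/-- `μ(T) = (1/((d−2)n+2)) Σ_{{i,j}∈E(T)} (d_i−x_i)(d_j−x_j)`. -/
noncomputable def muT (n : ℕ) (d x : Fin n → ℕ) (T : SimpleGraph (Fin n)) : ℝ :=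
  (∑ e ∈ T.edgeFinset,
    Sym2.lift ⟨fun i j => ((d i - x i : ℕ) : ℝ) * ((d j - x j : ℕ) : ℝ),
      fun i j => by ring⟩ e) / ((davg n d - 2) * n + 2)

/-- The set of labelled trees on `{1,…,n}` with degree sequence `x`. -/
noncomputable def treesWith (n : ℕ) (x : Fin n → ℕ) : Finset (SimpleGraph (Fin n)) :=
  Finset.univ.filter (fun T => T.IsTree ∧ ∀ j, T.degree j = x j)

/-- `μ̄(x)`, the average of `μ(T)` over trees `T` with degree sequence `x`. -/
noncomputable def mubar (n : ℕ) (d x : Fin n → ℕ) : ℝ :=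
  (∑ T ∈ treesWith n x, muT n d x T) / ((treesWith n x).card : ℝ)

/-- `g(x) = (R+d²)²/(4d²) − 1/4 − λ(x) − λ(x)² − μ̄(x)`. -/
noncomputable def gfun (n : ℕ) (d x : Fin n → ℕ) : ℝ :=
  (Rvar n d + davg n d ^ 2) ^ 2 / (4 * davg n d ^ 2) - 1 / 4
    - lamx n d x - lamx n d x ^ 2 - mubar n d x

/-! ### Averages over two finite sets linked by a biregular correspondence -/

/-- If `A` and `B` are linked by a biregular correspondence along which `f` and `g` differ by at
most `K`, then so do the average of `f` over `A` and that of `g` over `B`. -/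
lemma abs_average_sub_average_le {α β γ : Type*} (A : Finset α) (B : Finset β)
    (s : α → Finset γ) (t : β → Finset γ) {a b : ℕ} (ha : 0 < a) (hb : 0 < b)
    (hs : ∀ T ∈ A, (s T).card = a) (ht : ∀ T ∈ B, (t T).card = b)
    (F : α → γ → β) (G : β → γ → α)
    (hF : ∀ T ∈ A, ∀ v ∈ s T, F T v ∈ B ∧ v ∈ t (F T v) ∧ G (F T v) v = T)
    (hG : ∀ T ∈ B, ∀ v ∈ t T, G T v ∈ A ∧ v ∈ s (G T v) ∧ F (G T v) v = T)
    (f : α → ℝ) (g : β → ℝ) {K : ℝ} (hK : 0 ≤ K)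
    (hfg : ∀ T ∈ A, ∀ v ∈ s T, |f T - g (F T v)| ≤ K) :
    |(∑ T ∈ A, f T) / (A.card : ℝ) - (∑ T ∈ B, g T) / (B.card : ℝ)| ≤ K := by
  have hmove : ∀ h : β → ℝ, ∑ T ∈ A, ∑ v ∈ s T, h (F T v) = ∑ T ∈ B, ∑ _v ∈ t T, h T := by
    intro h
    rw [Finset.sum_sigma', Finset.sum_sigma']
    refine Finset.sum_bij' (fun p _ => ⟨F p.1 p.2, p.2⟩) (fun q _ => ⟨G q.1 q.2, q.2⟩)
      ?_ ?_ ?_ ?_ ?_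
    · rintro ⟨T, v⟩ hp
      rw [Finset.mem_sigma] at hp ⊢
      exact ⟨(hF T hp.1 v hp.2).1, (hF T hp.1 v hp.2).2.1⟩
    · rintro ⟨T, v⟩ hp
      rw [Finset.mem_sigma] at hp ⊢
      exact ⟨(hG T hp.1 v hp.2).1, (hG T hp.1 v hp.2).2.1⟩
    · rintro ⟨T, v⟩ hp
      rw [Finset.mem_sigma] at hp
      simp [(hF T hp.1 v hp.2).2.2]
    · rintro ⟨T, v⟩ hp
      rw [Finset.mem_sigma] at hp
      simp [(hG T hp.1 v hp.2).2.2]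
    · intros
      rfl
  have hA : ∀ h : α → ℝ, ∑ T ∈ A, ∑ _v ∈ s T, h T = a * ∑ T ∈ A, h T := by
    intro h
    rw [Finset.mul_sum]
    exact Finset.sum_congr rfl fun T hT => by simp [hs T hT]
  have hB : ∀ h : β → ℝ, ∑ T ∈ B, ∑ _v ∈ t T, h T = b * ∑ T ∈ B, h T := by
    intro h
    rw [Finset.mul_sum]
    exact Finset.sum_congr rfl fun T hT => by simp [ht T hT]
  have hcard : (a : ℝ) * A.card = b * B.card := by
    have h1 := hA fun _ => 1
    have h2 := hB fun _ => 1
    have h3 := hmove fun _ => 1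
    simp only [Finset.sum_const, nsmul_eq_mul, mul_one] at h1 h2 h3
    rw [← h1, ← h2, h3]
  have ha' : (0 : ℝ) < a := by exact_mod_cast ha
  have hb' : (0 : ℝ) < b := by exact_mod_cast hb
  have hdiff : |a * ∑ T ∈ A, f T - b * ∑ T ∈ B, g T| ≤ a * A.card * K := by
    rw [← hA, ← hB, ← hmove, ← Finset.sum_sub_distrib]
    calc |∑ T ∈ A, (∑ v ∈ s T, f T - ∑ v ∈ s T, g (F T v))|
        ≤ ∑ T ∈ A, ∑ _v ∈ s T, K := by
          refine (Finset.abs_sum_le_sum_abs _ _).trans (Finset.sum_le_sum fun T hT => ?_)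
          rw [← Finset.sum_sub_distrib]
          exact (Finset.abs_sum_le_sum_abs _ _).trans
            (Finset.sum_le_sum fun v hv => hfg T hT v hv)
      _ = a * A.card * K := by
          rw [hA fun _ => K]
          simp [mul_assoc]
  rcases Nat.eq_zero_or_pos A.card with h0 | hpos
  · have hB0 : (B.card : ℝ) = 0 := by
      rw [h0, Nat.cast_zero, mul_zero] at hcard
      rcases mul_eq_zero.mp hcard.symm with h | h
      · exact absurd h hb'.ne'
      · exact h
    simpa [h0, hB0] using hK
  · have hApos : (0 : ℝ) < A.card := by exact_mod_cast hpos
    have hBpos : (0 : ℝ) < B.card := by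
      by_contra hcon
      have : (b : ℝ) * B.card ≤ 0 := mul_nonpos_of_nonneg_of_nonpos hb'.le (not_lt.mp hcon)
      nlinarith [mul_pos ha' hApos]
    have e : (∑ T ∈ A, f T) / (A.card : ℝ) - (∑ T ∈ B, g T) / (B.card : ℝ)
        = (a * ∑ T ∈ A, f T - b * ∑ T ∈ B, g T) / (a * A.card) := by
      rw [sub_div, mul_div_mul_left _ _ ha'.ne', hcard, mul_div_mul_left _ _ hb'.ne']
    rw [e, abs_div, abs_of_pos (mul_pos ha' hApos), div_le_iff₀ (mul_pos ha' hApos)]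
    linarith

/-! ### Edge weights and moving a branch of a tree -/

section Graph

open SimpleGraph

variable {V : Type*}

/-- The product of the values of `y` at the two ends of an edge. -/
noncomputable def edgeWeight (y : V → ℕ) (e : Sym2 V) : ℝ :=
  Sym2.lift ⟨fun i j => (y i : ℝ) * (y j : ℝ), fun i j => by ring⟩ e

lemma edgeWeight_mk (y : V → ℕ) (a b : V) : edgeWeight y s(a, b) = (y a : ℝ) * y b := rfl

lemma edgeWeight_nonneg (y : V → ℕ) (e : Sym2 V) : 0 ≤ edgeWeight y e := by
  induction e with
  | _ a b =>
    rw [edgeWeight_mk]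
    positivity

lemma edgeWeight_le {y : V → ℕ} {D : ℕ} (hy : ∀ i, y i ≤ D) (e : Sym2 V) :
    edgeWeight y e ≤ (D : ℝ) ^ 2 := by
  induction e with
  | _ a b =>
    rw [edgeWeight_mk, sq]
    have ha : (y a : ℝ) ≤ D := by exact_mod_cast hy a
    have hb : (y b : ℝ) ≤ D := by exact_mod_cast hy b
    gcongr

lemma abs_edgeWeight_sub_le {y z : V → ℕ} {D : ℕ} (hy : ∀ i, y i ≤ D) (hz : ∀ i, z i ≤ D)
    (hyz : ∀ i, |(y i : ℝ) - z i| ≤ 1) (e : Sym2 V) :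
    |edgeWeight y e - edgeWeight z e| ≤ 2 * D := by
  induction e with
  | _ a b =>
    rw [edgeWeight_mk, edgeWeight_mk]
    have hb : |(y b : ℝ)| ≤ D := by
      rw [Nat.abs_cast]
      exact_mod_cast hy b
    have ha : |(z a : ℝ)| ≤ D := by
      rw [Nat.abs_cast]
      exact_mod_cast hz a
    calc |(y a : ℝ) * y b - z a * z b|
        = |((y a : ℝ) - z a) * y b + z a * (y b - z b)| := by ring_nf
      _ ≤ |((y a : ℝ) - z a) * y b| + |z a * ((y b : ℝ) - z b)| := abs_add_le _ _
      _ = |(y a : ℝ) - z a| * |(y b : ℝ)| + |(z a : ℝ)| * |(y b : ℝ) - z b| := by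
          rw [abs_mul, abs_mul]
      _ ≤ 1 * D + D * 1 := by
          gcongr
          · exact hyz a
          · exact hyz b
      _ = 2 * D := by ring

lemma deleteEdges_sup_edge {T : SimpleGraph V} {k v : V} (h : T.Adj k v) :
    T.deleteEdges {s(k, v)} ⊔ edge k v = T := by
  ext a b
  simp only [sup_adj, deleteEdges_adj, Set.mem_singleton_iff, adj_edge]
  constructor
  · rintro (h' | ⟨h', -⟩)
    · exact h'.1
    · rw [← mem_edgeSet, ← h']
      exact h
  · intro hab
    by_cases e : s(a, b) = s(k, v)
    · exact Or.inr ⟨e.symm, hab.ne⟩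
    · exact Or.inl ⟨hab, e⟩

lemma sup_edge_deleteEdges {H : SimpleGraph V} {j v : V} (h : ¬ H.Adj j v) :
    (H ⊔ edge j v).deleteEdges {s(j, v)} = H := by
  ext a b
  simp only [sup_adj, deleteEdges_adj, Set.mem_singleton_iff, adj_edge]
  constructor
  · rintro ⟨h' | h', h''⟩
    · exact h'
    · exact absurd h'.1.symm h''
  · intro hab
    refine ⟨Or.inl hab, fun e => h ?_⟩
    rw [← mem_edgeSet, ← e]
    exact hab

variable [Fintype V]

/-- The neighbours `v` of `k` not on the path from `k` to `j`. -/
noncomputable def movable (T : SimpleGraph V) (k j : V) : Finset V :=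
  Finset.univ.filter fun v => T.Adj k v ∧ (T.deleteEdges {s(k, v)}).Reachable k j

/-- The graph `T` with the edge `kv` replaced by `jv`. -/
noncomputable def moveEdge (T : SimpleGraph V) (k j v : V) : SimpleGraph V :=
  T.deleteEdges {s(k, v)} ⊔ edge j v

lemma mem_movable {T : SimpleGraph V} {k j v : V} :
    v ∈ movable T k j ↔ T.Adj k v ∧ (T.deleteEdges {s(k, v)}).Reachable k j := by
  simp [movable]

lemma card_movable_add_one {T : SimpleGraph V} (hT : T.IsTree) {k j : V} (hkj : k ≠ j) :
    (movable T k j).card + 1 = T.degree k := by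
  obtain ⟨p, hp, -⟩ := hT.existsUnique_path k j
  cases p with
  | nil => exact absurd rfl hkj
  | @cons _ w _ hkw q =>
    rw [Walk.cons_isPath_iff] at hp
    have hbridge := isAcyclic_iff_forall_adj_isBridge.mp hT.isAcyclic hkw
    have hq : ∀ v, s(k, v) ∉ q.edges := fun v hv => hp.2 (q.fst_mem_support_of_mem_edges hv)
    have hmov : movable T k j = (T.neighborFinset k).erase w := by
      ext v
      rw [mem_movable, Finset.mem_erase, mem_neighborFinset, and_comm]
      refine and_congr_left fun hkv => ⟨?_, fun hvw => ?_⟩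
      · rintro hr rfl
        exact hbridge (hr.trans (q.toDeleteEdge _ (hq v)).reachable.symm)
      · refine ((Walk.cons hkw q).toDeleteEdge s(k, v) ?_).reachable
        rw [Walk.edges_cons, List.mem_cons, not_or]
        exact ⟨fun h => hvw (Sym2.congr_right.mp h), hq v⟩
    rw [hmov, Finset.card_erase_of_mem (by simpa using hkw), card_neighborFinset_eq_degree]
    have := (T.degree_pos_iff_exists_adj k).mpr ⟨w, hkw⟩
    omega

section Movable

variable {T : SimpleGraph V} {k j v : V}

lemma not_reachable_of_mem_movable (hT : T.IsTree) (hv : v ∈ movable T k j) :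
    ¬ (T.deleteEdges {s(k, v)}).Reachable j v := fun h =>
  isAcyclic_iff_forall_adj_isBridge.mp hT.isAcyclic (mem_movable.mp hv).1
    ((mem_movable.mp hv).2.trans h)

lemma not_adj_of_mem_movable (hT : T.IsTree) (hv : v ∈ movable T k j) :
    ¬ (T.deleteEdges {s(k, v)}).Adj j v := fun h =>
  not_reachable_of_mem_movable hT hv h.reachable

lemma ne_of_mem_movable (hT : T.IsTree) (hv : v ∈ movable T k j) : j ≠ v := by
  rintro rfl
  exact not_reachable_of_mem_movable hT hv (Reachable.refl _)

lemma moveEdge_deleteEdges (hT : T.IsTree) (hv : v ∈ movable T k j) :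
    (moveEdge T k j v).deleteEdges {s(j, v)} = T.deleteEdges {s(k, v)} :=
  sup_edge_deleteEdges (not_adj_of_mem_movable hT hv)

lemma moveEdge_moveEdge (hT : T.IsTree) (hv : v ∈ movable T k j) :
    moveEdge (moveEdge T k j v) j k v = T := by
  rw [moveEdge, moveEdge_deleteEdges hT hv, deleteEdges_sup_edge (mem_movable.mp hv).1]

lemma mem_movable_moveEdge (hT : T.IsTree) (hv : v ∈ movable T k j) :
    v ∈ movable (moveEdge T k j v) j k := by
  rw [mem_movable, moveEdge_deleteEdges hT hv]
  refine ⟨?_, (mem_movable.mp hv).2.symm⟩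
  rw [moveEdge, sup_adj, adj_edge]
  exact Or.inr ⟨rfl, ne_of_mem_movable hT hv⟩

lemma isTree_moveEdge (hT : T.IsTree) (hv : v ∈ movable T k j) : (moveEdge T k j v).IsTree := by
  have hac : (T.deleteEdges {s(k, v)}).IsAcyclic := hT.isAcyclic.anti (deleteEdges_le _)
  have hle : T.deleteEdges {s(k, v)} ≤ moveEdge T k j v := le_sup_left
  have hjv : (moveEdge T k j v).Adj j v := (mem_movable.mp (mem_movable_moveEdge hT hv)).1
  have hkv : (moveEdge T k j v).Reachable k v :=
    ((mem_movable.mp hv).2.mono hle).trans hjv.reachable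
  have hstep : ∀ a b, T.Adj a b → (moveEdge T k j v).Reachable a b := by
    intro a b hab
    by_cases e : s(a, b) = s(k, v)
    · rcases Sym2.eq_iff.mp e with ⟨rfl, rfl⟩ | ⟨rfl, rfl⟩
      · exact hkv
      · exact hkv.symm
    · exact Adj.reachable (hle (deleteEdges_adj.mpr ⟨hab, e⟩))
  have := hT.connected.nonempty
  refine ⟨⟨fun a b => ?_⟩,
    IsAcyclic.sup_edge_of_not_reachable (not_reachable_of_mem_movable hT hv) hac⟩
  obtain ⟨p⟩ := hT.connected.preconnected a b
  induction p with
  | nil => exact Reachable.refl _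
  | cons h _ ih => exact (hstep _ _ h).trans ih

lemma degree_of_eq_sup_edge {G H : SimpleGraph V} (hG : G = H ⊔ edge j v) (h : ¬ H.Adj j v)
    (hjv : j ≠ v) (i : V) :
    G.degree i = H.degree i + (if i = j then 1 else 0) + if i = v then 1 else 0 := by
  have key : ∀ {a b : V}, G = H ⊔ edge a b → a ≠ b →
      G.neighborFinset a = insert b (H.neighborFinset a) := by
    intro a b hGab hab
    ext c
    simp only [hGab, mem_neighborFinset, sup_adj, edge_adj, Finset.mem_insert]
    grind
  by_cases hij : i = j
  · subst hij
    rw [← card_neighborFinset_eq_degree, key hG hjv, Finset.card_insert_of_notMem (by simpa using h)]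
    simp [hjv]
  by_cases hiv : i = v
  · subst hiv
    have h' : ¬ H.Adj i j := fun h' => h h'.symm
    rw [← card_neighborFinset_eq_degree, key (hG.trans (by rw [edge_comm])) hij,
      Finset.card_insert_of_notMem (by simpa using h')]
    simp [hij]
  · rw [← card_neighborFinset_eq_degree, ← card_neighborFinset_eq_degree]
    have : G.neighborFinset i = H.neighborFinset i := by
      ext c
      simp only [hG, mem_neighborFinset, sup_adj, edge_adj]
      grind
    rw [this]
    simp [hij, hiv]

lemma degree_moveEdge (hT : T.IsTree) (hv : v ∈ movable T k j) (i : V) :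
    (moveEdge T k j v).degree i + (if i = k then 1 else 0)
      = T.degree i + if i = j then 1 else 0 := by
  have hkv := (mem_movable.mp hv).1
  have h1 := degree_of_eq_sup_edge (G := moveEdge T k j v) rfl
    (not_adj_of_mem_movable hT hv) (ne_of_mem_movable hT hv) i
  have hk : ¬ (T.deleteEdges {s(k, v)}).Adj k v := by simp
  have h2 := degree_of_eq_sup_edge (deleteEdges_sup_edge hkv).symm hk hkv.ne i
  rw [h1, h2]
  omega

end Movable

/-! ### Change of the total edge weight -/

/-- Changing the vertex values by at most one at two vertices of degree at most `D` changes the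
total edge weight by at most `4 D ^ 2`. -/
lemma abs_sum_edgeWeight_sub_le (H : SimpleGraph V) {y z : V → ℕ} {D : ℕ} (j k : V)
    (hy : ∀ i, y i ≤ D) (hz : ∀ i, z i ≤ D) (hyz : ∀ i, |(y i : ℝ) - z i| ≤ 1)
    (heq : ∀ i, i ≠ j → i ≠ k → y i = z i) (hj : H.degree j ≤ D) (hk : H.degree k ≤ D) :
    |∑ e ∈ H.edgeFinset, edgeWeight y e - ∑ e ∈ H.edgeFinset, edgeWeight z e|
      ≤ 4 * (D : ℝ) ^ 2 := by
  have hzero : ∀ e ∈ H.edgeFinset, e ∉ H.incidenceFinset j ∪ H.incidenceFinset k →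
      edgeWeight y e - edgeWeight z e = 0 := by
    intro e he hne
    induction e with
    | _ a b =>
      have hab : H.Adj a b := by simpa using he
      simp only [Finset.mem_union, mem_incidenceFinset, mk'_mem_incidenceSet_iff, hab, true_and,
        not_or] at hne
      rw [edgeWeight_mk, edgeWeight_mk, heq a (by grind) (by grind), heq b (by grind) (by grind),
        sub_self]
  have hsub : H.incidenceFinset j ∪ H.incidenceFinset k ⊆ H.edgeFinset :=
    Finset.union_subset (H.incidenceFinset_subset j) (H.incidenceFinset_subset k)
  rw [← Finset.sum_sub_distrib, ← Finset.sum_subset hsub hzero]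
  have hcard : ((H.incidenceFinset j ∪ H.incidenceFinset k).card : ℝ) ≤ 2 * D := by
    have h := Finset.card_union_le (H.incidenceFinset j) (H.incidenceFinset k)
    rw [card_incidenceFinset_eq_degree, card_incidenceFinset_eq_degree] at h
    exact_mod_cast (by omega :
      (H.incidenceFinset j ∪ H.incidenceFinset k).card ≤ 2 * D)
  calc |∑ e ∈ H.incidenceFinset j ∪ H.incidenceFinset k, (edgeWeight y e - edgeWeight z e)|
      ≤ ∑ _e ∈ H.incidenceFinset j ∪ H.incidenceFinset k, 2 * (D : ℝ) :=
        (Finset.abs_sum_le_sum_abs _ _).trans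
          (Finset.sum_le_sum fun e _ => abs_edgeWeight_sub_le hy hz hyz e)
    _ = (H.incidenceFinset j ∪ H.incidenceFinset k).card * (2 * (D : ℝ)) := by simp
    _ ≤ 2 * D * (2 * D) := by gcongr
    _ = 4 * (D : ℝ) ^ 2 := by ring

lemma sum_edgeWeight_of_eq_sup_edge {G H : SimpleGraph V} {a b : V} (hG : G = H ⊔ edge a b)
    (h : ¬ H.Adj a b) (hab : a ≠ b) (y : V → ℕ) :
    ∑ e ∈ G.edgeFinset, edgeWeight y e
      = (y a : ℝ) * y b + ∑ e ∈ H.edgeFinset, edgeWeight y e := by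
  have hE : G.edgeFinset = insert s(a, b) H.edgeFinset := by
    ext e
    induction e with
    | _ c c' =>
      simp only [hG, mem_edgeFinset, mem_edgeSet, sup_adj, edge_adj, Finset.mem_insert, Sym2.eq_iff]
      grind
  rw [hE, Finset.sum_insert (by simpa using h), edgeWeight_mk]

lemma abs_sum_edgeWeight_sub_moveEdge_le {T : SimpleGraph V} (hT : T.IsTree) {k j v : V}
    (hv : v ∈ movable T k j) {y z : V → ℕ} {D : ℕ}
    (hy : ∀ i, y i ≤ D) (hz : ∀ i, z i ≤ D) (hyz : ∀ i, |(y i : ℝ) - z i| ≤ 1)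
    (heq : ∀ i, i ≠ j → i ≠ k → y i = z i) (hj : T.degree j ≤ D) (hk : T.degree k ≤ D) :
    |∑ e ∈ T.edgeFinset, edgeWeight y e - ∑ e ∈ (moveEdge T k j v).edgeFinset, edgeWeight z e|
      ≤ 5 * (D : ℝ) ^ 2 := by
  have hkv := (mem_movable.mp hv).1
  have hnk : ¬ (T.deleteEdges {s(k, v)}).Adj k v := by simp
  have h1 := sum_edgeWeight_of_eq_sup_edge (deleteEdges_sup_edge hkv).symm hnk hkv.ne y
  have h2 := sum_edgeWeight_of_eq_sup_edge (G := moveEdge T k j v) rfl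
    (not_adj_of_mem_movable hT hv) (ne_of_mem_movable hT hv) z
  have hdeg : ∀ {H : SimpleGraph V}, H ≤ T → ∀ i, H.degree i ≤ T.degree i := fun hH _ =>
    degree_le_of_le hH
  have h3 := abs_le.mp (abs_sum_edgeWeight_sub_le (T.deleteEdges {s(k, v)}) j k hy hz hyz heq
    ((hdeg (deleteEdges_le _) j).trans hj) ((hdeg (deleteEdges_le _) k).trans hk))
  have a1 := edgeWeight_nonneg y s(k, v)
  have a2 := edgeWeight_le hy s(k, v)
  have a3 := edgeWeight_nonneg z s(j, v)
  have a4 := edgeWeight_le hz s(j, v)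
  rw [edgeWeight_mk] at a1 a2 a3 a4
  rw [h1, h2, abs_le]
  constructor <;> linarith [h3.1, h3.2]

end Graph

/-! ### Bounds for `μ̄` and `λ` -/

lemma muT_eq (n : ℕ) (d x : Fin n → ℕ) (T : SimpleGraph (Fin n)) :
    muT n d x T = (∑ e ∈ T.edgeFinset, edgeWeight (fun i => d i - x i) e)
      / ((davg n d - 2) * n + 2) := rfl

lemma mem_treesWith {n : ℕ} {x : Fin n → ℕ} {T : SimpleGraph (Fin n)} :
    T ∈ treesWith n x ↔ T.IsTree ∧ ∀ i, T.degree i = x i := by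
  simp [treesWith]

lemma moveEdge_mem_treesWith {n : ℕ} {x x' : Fin n → ℕ} {j k v : Fin n} (hjk : j ≠ k)
    (hj : x' j = x j + 1) (hk : x' k + 1 = x k) (heq : ∀ i, i ≠ j → i ≠ k → x' i = x i)
    {T : SimpleGraph (Fin n)} (hT : T ∈ treesWith n x) (hv : v ∈ movable T k j) :
    moveEdge T k j v ∈ treesWith n x' := by
  obtain ⟨hT, hdeg⟩ := mem_treesWith.mp hT
  refine mem_treesWith.mpr ⟨isTree_moveEdge hT hv, fun i => ?_⟩
  have h := degree_moveEdge hT hv i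
  rw [hdeg] at h
  by_cases hij : i = j
  · subst hij
    simp [hjk] at h
    omega
  by_cases hik : i = k
  · subst hik
    simp [hij] at h
    omega
  · simp [hij, hik] at h
    rw [h, heq i hij hik]

lemma abs_mubar_sub_le {n D : ℕ} {d x x' : Fin n → ℕ} {j k : Fin n} (hD : ∀ i, d i ≤ D)
    (hN : 0 ≤ (davg n d - 2) * n) (hx : ∀ i, 1 ≤ x i) (hx' : ∀ i, 1 ≤ x' i)
    (hxd : ∀ i, x i ≤ d i) (hxd' : ∀ i, x' i ≤ d i) (hjk : j ≠ k)
    (hj : x' j = x j + 1) (hk : x' k + 1 = x k) (heq : ∀ i, i ≠ j → i ≠ k → x' i = x i) :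
    |mubar n d x - mubar n d x'| ≤ 5 * (D : ℝ) ^ 2 / ((davg n d - 2) * n + 2) := by
  have hpos : 0 < (davg n d - 2) * n + 2 := by linarith
  refine abs_average_sub_average_le (treesWith n x) (treesWith n x')
    (fun T => movable T k j) (fun T => movable T j k) (a := x' k) (b := x j) (hx' k) (hx j)
    ?_ ?_ (fun T v => moveEdge T k j v) (fun T v => moveEdge T j k v) ?_ ?_ _ _ (by positivity) ?_
  · intro T hT
    obtain ⟨hT, hdeg⟩ := mem_treesWith.mp hT
    have := card_movable_add_one hT hjk.symm
    rw [hdeg] at this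
    omega
  · intro T hT
    obtain ⟨hT, hdeg⟩ := mem_treesWith.mp hT
    have := card_movable_add_one hT hjk
    rw [hdeg] at this
    omega
  · intro T hT v hv
    have hTree := (mem_treesWith.mp hT).1
    exact ⟨moveEdge_mem_treesWith hjk hj hk heq hT hv, mem_movable_moveEdge hTree hv,
      moveEdge_moveEdge hTree hv⟩
  · intro T hT v hv
    have hTree := (mem_treesWith.mp hT).1
    exact ⟨moveEdge_mem_treesWith hjk.symm hk.symm hj.symm
      (fun i hik hij => (heq i hij hik).symm) hT hv, mem_movable_moveEdge hTree hv,
      moveEdge_moveEdge hTree hv⟩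
  · intro T hT v hv
    obtain ⟨hT, hdeg⟩ := mem_treesWith.mp hT
    rw [muT_eq, muT_eq, ← sub_div, abs_div, abs_of_pos hpos]
    gcongr
    refine abs_sum_edgeWeight_sub_moveEdge_le hT hv (fun i => ?_) (fun i => ?_) (fun i => ?_)
      (fun i hij hik => ?_) ?_ ?_
    · exact (Nat.sub_le _ _).trans (hD i)
    · exact (Nat.sub_le _ _).trans (hD i)
    · have hcases : x' i = x i + 1 ∨ x' i + 1 = x i ∨ x' i = x i := by
        by_cases hij : i = j
        · exact Or.inl (hij ▸ hj)
        by_cases hik : i = k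
        · exact Or.inr (Or.inl (hik ▸ hk))
        · exact Or.inr (Or.inr (heq i hij hik))
      rw [Nat.cast_sub (hxd i), Nat.cast_sub (hxd' i), abs_le]
      rcases hcases with h | h | h <;>
        · have h' := congrArg (Nat.cast : ℕ → ℝ) h
          push_cast at h'
          constructor <;> linarith
    · simp [heq i hij hik]
    · rw [hdeg]
      exact (hxd j).trans (hD j)
    · rw [hdeg]
      exact (hxd k).trans (hD k)

lemma cast_descFactorial_two (m : ℕ) : ((Nat.descFactorial m 2 : ℕ) : ℝ) = m * (m - 1) := by
  cases m with
  | zero => simp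
  | succ m =>
    simp [Nat.descFactorial_succ, mul_comm]

lemma davg_sub_two_mul {n : ℕ} (hn : n ≠ 0) (d : Fin n → ℕ) :
    (davg n d - 2) * n = ∑ i, (d i : ℝ) - 2 * n := by
  have : (n : ℝ) ≠ 0 := by exact_mod_cast hn
  rw [davg, sub_mul, div_mul_cancel₀ _ this]

lemma lamx_nonneg {n : ℕ} {d : Fin n → ℕ} (hN : 0 ≤ (davg n d - 2) * n) (x : Fin n → ℕ) :
    0 ≤ lamx n d x := by
  unfold lamx
  positivity

lemma lamx_le {n D : ℕ} {d x : Fin n → ℕ} (hn : n ≠ 0) (hD : ∀ i, d i ≤ D)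
    (hN : 0 ≤ (davg n d - 2) * n) (hxd : ∀ i, x i ≤ d i) (hsum : (∑ i, x i) + 2 = 2 * n) :
    lamx n d x ≤ D / 2 := by
  have hy : ∑ i, ((d i - x i : ℕ) : ℝ) = (davg n d - 2) * n + 2 := by
    have hsum' : (∑ i, (x i : ℝ)) + 2 = 2 * n := by exact_mod_cast hsum
    rw [davg_sub_two_mul hn, Finset.sum_congr rfl fun i _ => Nat.cast_sub (hxd i),
      Finset.sum_sub_distrib]
    linarith
  have hnum : ∑ i, (Nat.descFactorial (d i - x i) 2 : ℝ) ≤ D * ((davg n d - 2) * n + 2) := by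
    rw [← hy, Finset.mul_sum]
    refine Finset.sum_le_sum fun i _ => ?_
    rw [cast_descFactorial_two]
    have h1 : ((d i - x i : ℕ) : ℝ) ≤ D := by exact_mod_cast (Nat.sub_le _ _).trans (hD i)
    have h0 : (0 : ℝ) ≤ ((d i - x i : ℕ) : ℝ) := Nat.cast_nonneg _
    nlinarith
  rw [lamx, div_le_iff₀ (by linarith)]
  linarith

lemma abs_lamx_sub_le {n D : ℕ} {d x x' : Fin n → ℕ} {j k : Fin n} (hD : ∀ i, d i ≤ D)
    (hN : 0 ≤ (davg n d - 2) * n) (hxd : ∀ i, x i ≤ d i) (hxd' : ∀ i, x' i ≤ d i)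
    (hj : x' j = x j + 1) (hk : x' k + 1 = x k) (heq : ∀ i, i ≠ j → i ≠ k → x' i = x i) :
    |lamx n d x - lamx n d x'| ≤ 4 * (D : ℝ) / (2 * ((davg n d - 2) * n) + 4) := by
  have hpos : 0 < 2 * ((davg n d - 2) * n) + 4 := by linarith
  have hstep : ∀ m : ℕ, m + 1 ≤ D →
      |(Nat.descFactorial (m + 1) 2 : ℝ) - Nat.descFactorial m 2| ≤ 2 * D := by
    intro m hm
    have hm' : (m : ℝ) + 1 ≤ D := by exact_mod_cast hm
    have h0 : (0 : ℝ) ≤ m := Nat.cast_nonneg _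
    rw [cast_descFactorial_two, cast_descFactorial_two, abs_le]
    push_cast
    constructor <;> nlinarith
  rw [lamx, lamx, ← sub_div, abs_div, abs_of_pos hpos, ← Finset.sum_sub_distrib]
  gcongr
  calc |∑ i, ((Nat.descFactorial (d i - x i) 2 : ℝ) - Nat.descFactorial (d i - x' i) 2)|
      ≤ ∑ i, ((if i = j then 2 * (D : ℝ) else 0) + if i = k then 2 * (D : ℝ) else 0) := by
        refine (Finset.abs_sum_le_sum_abs _ _).trans (Finset.sum_le_sum fun i _ => ?_)
        by_cases hij : i = j
        · subst hij
          have e : d i - x i = (d i - x' i) + 1 := by have := hxd' i; omega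
          have h := hstep (d i - x' i) (by have := hD i; omega)
          rw [e, if_pos rfl]
          refine h.trans (le_add_of_nonneg_right ?_)
          split_ifs <;> positivity
        by_cases hik : i = k
        · subst hik
          have e : d i - x' i = (d i - x i) + 1 := by have := hxd i; omega
          have h := hstep (d i - x i) (by have := hD i; omega)
          rw [e, abs_sub_comm, if_neg hij, if_pos rfl, zero_add]
          exact h
        · simp [heq i hij hik, hij, hik]
    _ = 4 * (D : ℝ) := by
        rw [Finset.sum_add_distrib]
        simp only [Finset.sum_ite_eq', Finset.mem_univ, if_true]
        ring

theorem g_adjacent_bound :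
    ∃ C : ℝ, 0 < C ∧ ∀ n : ℕ, ∀ d : Fin n → ℕ,
      (∀ j, 1 ≤ d j) → Even (∑ j, d j) →
      ((Finset.univ.sup d : ℕ) : ℝ) ^ 4 ≤ (davg n d - 2) * n →
      ∀ x x' : Fin n → ℕ,
      -- `x` and `x'` are suitable degree sequences
      (∀ j, 1 ≤ x j) → (∀ j, x j ≤ d j) → (∑ j, x j) + 2 = 2 * n →
      (∀ j, 1 ≤ x' j) → (∀ j, x' j ≤ d j) → (∑ j, x' j) + 2 = 2 * n →
      -- `x` and `x'` are adjacent
      (∃ j k : Fin n, j ≠ k ∧ x' j = x j + 1 ∧ x' k = x k - 1 ∧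
        ∀ i, i ≠ j → i ≠ k → x' i = x i) →
      |gfun n d x - gfun n d x'| ≤
        C * ((Finset.univ.sup d : ℕ) : ℝ) ^ 2 / ((davg n d - 2) * n) := by
  refine ⟨9, by norm_num, ?_⟩
  intro n d hd _ hmax x x' hx hxd hsum hx' hxd' hsum' ⟨j, k, hjk, hj, hk, heq⟩
  have hk' : x' k + 1 = x k := by
    have := hx k
    omega
  have hn : n ≠ 0 := (j.pos).ne'
  have hD : ∀ i, d i ≤ Finset.univ.sup d := fun i => Finset.le_sup (Finset.mem_univ i)
  have hD1 : (1 : ℝ) ≤ (Finset.univ.sup d : ℕ) := by exact_mod_cast (hd j).trans (hD j)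
  have hN : 0 < (davg n d - 2) * n := lt_of_lt_of_le (by positivity) hmax
  have hlam := abs_lamx_sub_le hD hN.le hxd hxd' hj hk' heq
  have hmu := abs_mubar_sub_le hD hN.le hx hx' hxd hxd' hjk hj hk' heq
  have l1 := lamx_nonneg hN.le x
  have l2 := lamx_nonneg hN.le x'
  have l3 := lamx_le hn hD hN.le hxd hsum
  have l4 := lamx_le hn hD hN.le hxd' hsum'
  generalize ((Finset.univ.sup d : ℕ) : ℝ) = D at *
  generalize (davg n d - 2) * n = N at *
  have hlam' : |lamx n d x - lamx n d x'| ≤ 2 * D / N := by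
    refine hlam.trans ?_
    rw [div_le_div_iff₀ (by linarith) hN]
    nlinarith
  have hmu' : |mubar n d x - mubar n d x'| ≤ 5 * D ^ 2 / N := by
    refine hmu.trans ?_
    gcongr
    linarith
  have hsq : |(lamx n d x - lamx n d x') * (1 + lamx n d x + lamx n d x')|
      ≤ 2 * D / N * (2 * D) := by
    rw [abs_mul]
    gcongr
    rw [abs_of_nonneg (by linarith)]
    linarith
  have e : gfun n d x - gfun n d x'
      = -((lamx n d x - lamx n d x') * (1 + lamx n d x + lamx n d x'))
        - (mubar n d x - mubar n d x') := by
    unfold gfun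
    ring
  calc |gfun n d x - gfun n d x'|
      ≤ |(lamx n d x - lamx n d x') * (1 + lamx n d x + lamx n d x')|
        + |mubar n d x - mubar n d x'| := by
        rw [e]
        refine (abs_sub _ _).trans ?_
        rw [abs_neg]
    _ ≤ 2 * D / N * (2 * D) + 5 * D ^ 2 / N := add_le_add hsq hmu'
    _ = 9 * D ^ 2 / N := by ring

end ExpectedSpanningTrees
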